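/- arXiv:math/9904025 — 3 statements merged into one kernel-verified Lean document; each statement's English description precedes it below -/
import Mathlib

section
/- Let a be the boundary Lie algebra (basis h, h', e, f; nonzero brackets [h,e]=4p·e, [h,f]=-4p·f, [e,f]=(p/2)·h', p ≠ 0), and let U(a) be its universal enveloping algebra. The element Ω = (1/8)(h ⊗ h' + h' ⊗ h) + e ⊗ f + f ⊗ e ∈ U(a) ⊗ U(a) is symmetric under the flip of tensor factors and is ad-invariant: for every x ∈ a, the commutator [x ⊗ 1 + 1 ⊗ x, Ω] vanishes in U(a) ⊗ U(a). -/
noncomputable section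
open scoped TensorProduct

noncomputable section

/-- The carrier of the boundary Lie algebra `a` (depends on the parameter `p`);
coordinates are taken with respect to the basis `h, h', e, f`. -/
def BoundaryA (_p : ℂ) : Type := ℂ × ℂ × ℂ × ℂ

namespace BoundaryA

variable {p : ℂ}

instance : AddCommGroup (BoundaryA p) := inferInstanceAs (AddCommGroup (ℂ × ℂ × ℂ × ℂ))
instance : Module ℂ (BoundaryA p) := inferInstanceAs (Module ℂ (ℂ × ℂ × ℂ × ℂ))
instance : Module.Finite ℂ (BoundaryA p) := inferInstanceAs (Module.Finite ℂ (ℂ × ℂ × ℂ × ℂ))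

/-- Build an element of `a` from its coordinates in the basis `h, h', e, f`. -/
def mk' (a b c d : ℂ) : BoundaryA p := (a, b, c, d)

/-- coefficient of `h` -/
def cH (x : BoundaryA p) : ℂ := x.1
/-- coefficient of `h'` -/
def cH' (x : BoundaryA p) : ℂ := x.2.1
/-- coefficient of `e` -/
def cE (x : BoundaryA p) : ℂ := x.2.2.1
/-- coefficient of `f` -/
def cF (x : BoundaryA p) : ℂ := x.2.2.2

/-- The basis vector `h`. -/
def h : BoundaryA p := mk' 1 0 0 0
/-- The basis vector `h'`. -/
def h' : BoundaryA p := mk' 0 1 0 0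
/-- The basis vector `e`. -/
def e : BoundaryA p := mk' 0 0 1 0
/-- The basis vector `f`. -/
def f : BoundaryA p := mk' 0 0 0 1

/-- The bracket of the boundary Lie algebra `a`: the bilinear antisymmetric extension of
`[h,e] = 4p·e`, `[h,f] = -4p·f`, `[e,f] = (p/2)·h'`, `[h,h'] = [h',e] = [h',f] = 0`. -/
def br (x y : BoundaryA p) : BoundaryA p :=
  mk' 0
      (p / 2 * (cE x * cF y - cF x * cE y))
      (4 * p * (cH x * cE y - cE x * cH y))
      (-(4 * p) * (cH x * cF y - cF x * cH y))

lemma ext4 {x y : BoundaryA p} (h1 : cH x = cH y) (h2 : cH' x = cH' y)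
    (h3 : cE x = cE y) (h4 : cF x = cF y) : x = y := by
  exact Prod.ext h1 (Prod.ext h2 (Prod.ext h3 h4))

@[simp] lemma cH_mk (a b c d : ℂ) : cH (mk' a b c d : BoundaryA p) = a := rfl
@[simp] lemma cH'_mk (a b c d : ℂ) : cH' (mk' a b c d : BoundaryA p) = b := rfl
@[simp] lemma cE_mk (a b c d : ℂ) : cE (mk' a b c d : BoundaryA p) = c := rfl
@[simp] lemma cF_mk (a b c d : ℂ) : cF (mk' a b c d : BoundaryA p) = d := rfl

@[simp] lemma cH_add (x y : BoundaryA p) : cH (x + y) = cH x + cH y := rfl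
@[simp] lemma cH'_add (x y : BoundaryA p) : cH' (x + y) = cH' x + cH' y := rfl
@[simp] lemma cE_add (x y : BoundaryA p) : cE (x + y) = cE x + cE y := rfl
@[simp] lemma cF_add (x y : BoundaryA p) : cF (x + y) = cF x + cF y := rfl

@[simp] lemma cH_smul (t : ℂ) (x : BoundaryA p) : cH (t • x) = t * cH x := rfl
@[simp] lemma cH'_smul (t : ℂ) (x : BoundaryA p) : cH' (t • x) = t * cH' x := rfl
@[simp] lemma cE_smul (t : ℂ) (x : BoundaryA p) : cE (t • x) = t * cE x := rfl
@[simp] lemma cF_smul (t : ℂ) (x : BoundaryA p) : cF (t • x) = t * cF x := rfl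

@[simp] lemma cH_neg (x : BoundaryA p) : cH (-x) = -cH x := rfl
@[simp] lemma cH'_neg (x : BoundaryA p) : cH' (-x) = -cH' x := rfl
@[simp] lemma cE_neg (x : BoundaryA p) : cE (-x) = -cE x := rfl
@[simp] lemma cF_neg (x : BoundaryA p) : cF (-x) = -cF x := rfl

@[simp] lemma cH_zero : cH (0 : BoundaryA p) = 0 := rfl
@[simp] lemma cH'_zero : cH' (0 : BoundaryA p) = 0 := rfl
@[simp] lemma cE_zero : cE (0 : BoundaryA p) = 0 := rfl
@[simp] lemma cF_zero : cF (0 : BoundaryA p) = 0 := rfl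

instance : LieRing (BoundaryA p) where
  bracket := br
  add_lie x y z := by refine ext4 ?_ ?_ ?_ ?_ <;> simp only [br, cH_mk, cH'_mk, cE_mk, cF_mk, cH_add, cH'_add, cE_add, cF_add, cH_zero, cH'_zero, cE_zero, cF_zero] <;> ring
  lie_add x y z := by refine ext4 ?_ ?_ ?_ ?_ <;> simp only [br, cH_mk, cH'_mk, cE_mk, cF_mk, cH_add, cH'_add, cE_add, cF_add, cH_zero, cH'_zero, cE_zero, cF_zero] <;> ring
  lie_self x := by refine ext4 ?_ ?_ ?_ ?_ <;> simp only [br, cH_mk, cH'_mk, cE_mk, cF_mk, cH_add, cH'_add, cE_add, cF_add, cH_zero, cH'_zero, cE_zero, cF_zero] <;> ring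
  leibniz_lie x y z := by refine ext4 ?_ ?_ ?_ ?_ <;> simp only [br, cH_mk, cH'_mk, cE_mk, cF_mk, cH_add, cH'_add, cE_add, cF_add, cH_zero, cH'_zero, cE_zero, cF_zero] <;> ring

instance : LieAlgebra ℂ (BoundaryA p) where
  lie_smul t x y := by refine ext4 ?_ ?_ ?_ ?_ <;> simp only [Bracket.bracket, br, cH_mk, cH'_mk, cE_mk, cF_mk, cH_smul, cH'_smul, cE_smul, cF_smul] <;> ring

@[simp] lemma lie_def (x y : BoundaryA p) : ⁅x, y⁆ = br x y := rfl

lemma lie_h_e : ⁅(h : BoundaryA p), (e : BoundaryA p)⁆ = (4 * p) • e := by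
  refine ext4 ?_ ?_ ?_ ?_ <;> simp [br, h, e]

lemma lie_h_f : ⁅(h : BoundaryA p), (f : BoundaryA p)⁆ = (-(4 * p)) • f := by
  refine ext4 ?_ ?_ ?_ ?_ <;> simp [br, h, f]

lemma lie_e_f : ⁅(e : BoundaryA p), (f : BoundaryA p)⁆ = (p / 2) • h' := by
  refine ext4 ?_ ?_ ?_ ?_ <;> simp [br, h', e, f]

lemma lie_h_h' : ⁅(h : BoundaryA p), (h' : BoundaryA p)⁆ = 0 := by
  refine ext4 ?_ ?_ ?_ ?_ <;> simp [br, h, h']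

end BoundaryA

/-- The universal enveloping algebra `U(a)` of the boundary Lie algebra `a`. -/
abbrev UEnvA (p : ℂ) := UniversalEnvelopingAlgebra ℂ (BoundaryA p)

attribute [local instance 100] LieRing.ofAssociativeRing

/-- The canonical embedding `a → U(a)`. -/
def iotaA (p : ℂ) : BoundaryA p →ₗ⁅ℂ⁆ UEnvA p := UniversalEnvelopingAlgebra.ι ℂ

/-- The element `Ω = (1/8)(h ⊗ h' + h' ⊗ h) + e ⊗ f + f ⊗ e ∈ U(a) ⊗ U(a)`. -/
def OmegaA (p : ℂ) : UEnvA p ⊗[ℂ] UEnvA p :=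
  (1 / 8 : ℂ) • (iotaA p BoundaryA.h ⊗ₜ iotaA p BoundaryA.h'
      + iotaA p BoundaryA.h' ⊗ₜ iotaA p BoundaryA.h)
    + iotaA p BoundaryA.e ⊗ₜ iotaA p BoundaryA.f
    + iotaA p BoundaryA.f ⊗ₜ iotaA p BoundaryA.e

namespace BoundaryA

variable {p : ℂ}

lemma lie_h_right (x : BoundaryA p) :
    ⁅x, (h : BoundaryA p)⁆ = (-(4 * p * cE x)) • e + (4 * p * cF x) • f := by
  refine ext4 ?_ ?_ ?_ ?_ <;> simp [br, h, e, f]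

lemma lie_h'_right (x : BoundaryA p) : ⁅x, (h' : BoundaryA p)⁆ = 0 := by
  refine ext4 ?_ ?_ ?_ ?_ <;> simp [br, h']

lemma lie_e_right (x : BoundaryA p) :
    ⁅x, (e : BoundaryA p)⁆ = (4 * p * cH x) • e + (-(p / 2 * cF x)) • h' := by
  refine ext4 ?_ ?_ ?_ ?_ <;> simp [br, e, h']

lemma lie_f_right (x : BoundaryA p) :
    ⁅x, (f : BoundaryA p)⁆ = (p / 2 * cE x) • h' + (-(4 * p * cH x)) • f := by
  refine ext4 ?_ ?_ ?_ ?_ <;> simp [br, f, h']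

end BoundaryA

/-- The primitive element `x ⊗ 1 + 1 ⊗ x` acts on pure tensors by the Leibniz rule. -/
lemma commutator_primitive_tmul (p : ℂ) (x a b : BoundaryA p) :
    (iotaA p x ⊗ₜ[ℂ] 1 + 1 ⊗ₜ[ℂ] iotaA p x) * (iotaA p a ⊗ₜ[ℂ] iotaA p b)
      - (iotaA p a ⊗ₜ[ℂ] iotaA p b) * (iotaA p x ⊗ₜ[ℂ] 1 + 1 ⊗ₜ[ℂ] iotaA p x)
      = iotaA p ⁅x, a⁆ ⊗ₜ[ℂ] iotaA p b + iotaA p a ⊗ₜ[ℂ] iotaA p ⁅x, b⁆ := by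
  rw [LieHom.map_lie, LieHom.map_lie, LieRing.of_associative_ring_bracket,
    LieRing.of_associative_ring_bracket, TensorProduct.sub_tmul, TensorProduct.tmul_sub]
  simp only [add_mul, mul_add, Algebra.TensorProduct.tmul_mul_tmul, one_mul, mul_one]
  abel

/-- the element `Ω = (1/8)(h ⊗ h' + h' ⊗ h) + e ⊗ f + f ⊗ e` of
`U(a) ⊗ U(a)` is symmetric under the flip of tensor factors and ad-invariant. -/
theorem statement6 (p : ℂ) (hp : p ≠ 0) :
    (Algebra.TensorProduct.comm ℂ (UEnvA p) (UEnvA p)) (OmegaA p) = OmegaA p ∧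
    ∀ x : BoundaryA p,
      (iotaA p x ⊗ₜ 1 + 1 ⊗ₜ iotaA p x) * OmegaA p
        - OmegaA p * (iotaA p x ⊗ₜ 1 + 1 ⊗ₜ iotaA p x) = 0 := by
  refine ⟨?_, fun x => ?_⟩
  · simp only [OmegaA, map_add, map_smul, Algebra.TensorProduct.comm_tmul]
    module
  · have key := commutator_primitive_tmul p x
    have hh' := key BoundaryA.h BoundaryA.h'
    have h'h := key BoundaryA.h' BoundaryA.h
    have ef := key BoundaryA.e BoundaryA.f
    have fe := key BoundaryA.f BoundaryA.e
    simp only [BoundaryA.lie_h_right, BoundaryA.lie_h'_right, BoundaryA.lie_e_right,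
      BoundaryA.lie_f_right, map_add, map_smul, map_zero,
      TensorProduct.add_tmul, TensorProduct.tmul_add, TensorProduct.tmul_zero,
      TensorProduct.zero_tmul, TensorProduct.tmul_smul, ← TensorProduct.smul_tmul']
      at hh' h'h ef fe
    generalize iotaA p x ⊗ₜ[ℂ] (1 : UEnvA p) + (1 : UEnvA p) ⊗ₜ[ℂ] iotaA p x = D at *
    rw [OmegaA]
    simp only [mul_add, add_mul, mul_smul_comm, smul_mul_assoc]
    linear_combination (norm := module) (1 / 8 : ℂ) • hh' + (1 / 8 : ℂ) • h'h + ef + fe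
end
end
end

section
/- Let a be the boundary Lie algebra (basis h, h', e, f; nonzero brackets [h,e]=4p·e, [h,f]=-4p·f, [e,f]=(p/2)·h', p ≠ 0) and Ω = (1/8)(h ⊗ h' + h' ⊗ h) + e ⊗ f + f ⊗ e ∈ U(a) ⊗ U(a). For pairwise distinct complex numbers u, v, w, the rational r-matrix r(u,v) = Ω/(u-v) satisfies the parametric classical Yang–Baxter equation in U(a)⊗U(a)⊗U(a): [r₁₂(u,v), r₁₃(u,w)] + [r₁₂(u,v), r₂₃(v,w)] + [r₁₃(u,w), r₂₃(v,w)] = 0, where r₁₂, r₁₃, r₂₃ denote the placements of r in the indicated pairs of tensor factors (with 1 in the remaining factor). -/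
noncomputable section
open scoped TensorProduct

noncomputable section

attribute [local instance 100] LieRing.ofAssociativeRing

section Placements

variable (K : Type*) [CommSemiring K] (U : Type*) [Semiring U] [Algebra K U]

/-- For `X = Σ xᵢ ⊗ yᵢ` in `U ⊗ U`, `place12 K U X = X₁₂ = Σ xᵢ ⊗ yᵢ ⊗ 1`
in `U ⊗ U ⊗ U`. -/
def place12 : U ⊗[K] U →ₐ[K] U ⊗[K] (U ⊗[K] U) :=
  Algebra.TensorProduct.map (AlgHom.id K U)
    (Algebra.TensorProduct.includeLeft : U →ₐ[K] U ⊗[K] U)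

/-- For `X = Σ xᵢ ⊗ yᵢ` in `U ⊗ U`, `place13 K U X = X₁₃ = Σ xᵢ ⊗ 1 ⊗ yᵢ`
in `U ⊗ U ⊗ U`. -/
def place13 : U ⊗[K] U →ₐ[K] U ⊗[K] (U ⊗[K] U) :=
  Algebra.TensorProduct.map (AlgHom.id K U)
    (Algebra.TensorProduct.includeRight : U →ₐ[K] U ⊗[K] U)

/-- For `X = Σ xᵢ ⊗ yᵢ` in `U ⊗ U`, `place23 K U X = X₂₃ = Σ 1 ⊗ xᵢ ⊗ yᵢ`
in `U ⊗ U ⊗ U`. -/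
def place23 : U ⊗[K] U →ₐ[K] U ⊗[K] (U ⊗[K] U) :=
  Algebra.TensorProduct.includeRight

end Placements

section ClassicalYangBaxter

variable {A : Type*} [Ring A] [Algebra ℂ A]

/-- A tensor `Ω` of the shape of `OmegaA`, over elements `h, k, e, f` (with `k` in the role of `h'`)
of an arbitrary algebra. -/
def splitCasimir (h k e f : A) : A ⊗[ℂ] A :=
  (1 / 8 : ℂ) • (h ⊗ₜ k + k ⊗ₜ h) + e ⊗ₜ f + f ⊗ₜ e

variable {p : ℂ} {h k e f : A}

lemma place12_splitCasimir_commute (hhe : h * e = e * h + (4 * p) • e)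
    (hhf : h * f = f * h - (4 * p) • f) (hef : e * f = f * e + (p / 2) • k)
    (hhk : h * k = k * h) (hke : k * e = e * k) (hkf : k * f = f * k) :
    Commute (place12 ℂ A (splitCasimir h k e f))
      (place13 ℂ A (splitCasimir h k e f) + place23 ℂ A (splitCasimir h k e f)) := by
  simp only [commute_iff_eq, place12, place13, place23, splitCasimir, map_add, map_smul,
    Algebra.TensorProduct.map_tmul, Algebra.TensorProduct.includeLeft_apply,
    Algebra.TensorProduct.includeRight_apply, AlgHom.id_apply, mul_add, add_mul, smul_mul_assoc,
    mul_smul_comm, Algebra.TensorProduct.tmul_mul_tmul, one_mul, mul_one, hhe, hhf, hef, hhk, hke,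
    hkf, TensorProduct.tmul_add, TensorProduct.add_tmul, TensorProduct.sub_tmul,
    TensorProduct.tmul_sub, TensorProduct.tmul_smul, ← TensorProduct.smul_tmul']
  module

lemma commute_place23_splitCasimir (hhe : h * e = e * h + (4 * p) • e)
    (hhf : h * f = f * h - (4 * p) • f) (hef : e * f = f * e + (p / 2) • k)
    (hhk : h * k = k * h) (hke : k * e = e * k) (hkf : k * f = f * k) :
    Commute (place12 ℂ A (splitCasimir h k e f) + place13 ℂ A (splitCasimir h k e f))
      (place23 ℂ A (splitCasimir h k e f)) := by
  simp only [commute_iff_eq, place12, place13, place23, splitCasimir, map_add, map_smul,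
    Algebra.TensorProduct.map_tmul, Algebra.TensorProduct.includeLeft_apply,
    Algebra.TensorProduct.includeRight_apply, AlgHom.id_apply, mul_add, add_mul, smul_mul_assoc,
    mul_smul_comm, Algebra.TensorProduct.tmul_mul_tmul, one_mul, mul_one, hhe, hhf, hef, hhk, hke,
    hkf, TensorProduct.tmul_add, TensorProduct.add_tmul, TensorProduct.sub_tmul,
    TensorProduct.tmul_sub, TensorProduct.tmul_smul, ← TensorProduct.smul_tmul']
  module

/-- The infinitesimal braid relations imply the parametric classical Yang–Baxter equation. -/
lemma yangBaxter_of_commute {x y z : A} (hx : Commute x (y + z)) (hz : Commute (x + y) z)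
    {u v w : ℂ} (huv : u ≠ v) (huw : u ≠ w) (hvw : v ≠ w) :
    ((u - v)⁻¹ • x * (u - w)⁻¹ • y - (u - w)⁻¹ • y * (u - v)⁻¹ • x)
      + ((u - v)⁻¹ • x * (v - w)⁻¹ • z - (v - w)⁻¹ • z * (u - v)⁻¹ • x)
      + ((u - w)⁻¹ • y * (v - w)⁻¹ • z - (v - w)⁻¹ • z * (u - w)⁻¹ • y) = 0 := by
  have hxz : x * z - z * x = -(x * y - y * x) := by
    have := hx.eq
    rw [mul_add, add_mul] at this
    linear_combination (norm := abel) this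
  have hyz : y * z - z * y = x * y - y * x := by
    have := hz.eq
    rw [mul_add, add_mul] at this
    linear_combination (norm := abel) this - hxz
  have hscalar : (u - v)⁻¹ * (u - w)⁻¹ - (u - v)⁻¹ * (v - w)⁻¹ + (u - w)⁻¹ * (v - w)⁻¹ = 0 := by
    have := sub_ne_zero.mpr huv
    have := sub_ne_zero.mpr huw
    have := sub_ne_zero.mpr hvw
    field_simp
    ring
  calc
    _ = ((u - v)⁻¹ * (u - w)⁻¹) • (x * y - y * x) + ((u - v)⁻¹ * (v - w)⁻¹) • (x * z - z * x)
        + ((u - w)⁻¹ * (v - w)⁻¹) • (y * z - z * y) := by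
      simp only [smul_mul_smul_comm]
      module
    _ = ((u - v)⁻¹ * (u - w)⁻¹ - (u - v)⁻¹ * (v - w)⁻¹ + (u - w)⁻¹ * (v - w)⁻¹)
        • (x * y - y * x) := by
      rw [hxz, hyz]
      module
    _ = 0 := by rw [hscalar, zero_smul]

end ClassicalYangBaxter

lemma iotaA_mul (p : ℂ) (x y : BoundaryA p) :
    iotaA p x * iotaA p y = iotaA p y * iotaA p x + iotaA p ⁅x, y⁆ := by
  rw [LieHom.map_lie, LieRing.of_associative_ring_bracket]
  abel

namespace BoundaryA

variable {p : ℂ}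

lemma lie_h'_e : ⁅(h' : BoundaryA p), (e : BoundaryA p)⁆ = 0 := by
  refine ext4 ?_ ?_ ?_ ?_ <;> simp [br, h', e]

lemma lie_h'_f : ⁅(h' : BoundaryA p), (f : BoundaryA p)⁆ = 0 := by
  refine ext4 ?_ ?_ ?_ ?_ <;> simp [br, h', f]

end BoundaryA

/-- for pairwise distinct complex numbers `u, v, w`, the rational r-matrix
`r(u,v) = Ω/(u-v)` built from the canonical element `Ω` of the boundary Lie algebra `a`
satisfies the parametric classical Yang–Baxter equation in `U(a)⊗U(a)⊗U(a)`. -/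
theorem statement7 (p : ℂ) (hp : p ≠ 0) (u v w : ℂ)
    (huv : u ≠ v) (huw : u ≠ w) (hvw : v ≠ w) :
    (let r12 := (u - v)⁻¹ • place12 ℂ (UEnvA p) (OmegaA p)
     let r13 := (u - w)⁻¹ • place13 ℂ (UEnvA p) (OmegaA p)
     let r23 := (v - w)⁻¹ • place23 ℂ (UEnvA p) (OmegaA p)
     (r12 * r13 - r13 * r12) + (r12 * r23 - r23 * r12) + (r13 * r23 - r23 * r13) = 0) := by
  have hhe := iotaA_mul p .h .e
  have hhf := iotaA_mul p .h .f
  have hef := iotaA_mul p .e .f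
  have hhk := iotaA_mul p .h .h'
  have hke := iotaA_mul p .h' .e
  have hkf := iotaA_mul p .h' .f
  rw [BoundaryA.lie_h_e, map_smul] at hhe
  rw [BoundaryA.lie_h_f, map_smul, neg_smul, ← sub_eq_add_neg] at hhf
  rw [BoundaryA.lie_e_f, map_smul] at hef
  rw [BoundaryA.lie_h_h', map_zero, add_zero] at hhk
  rw [BoundaryA.lie_h'_e, map_zero, add_zero] at hke
  rw [BoundaryA.lie_h'_f, map_zero, add_zero] at hkf
  exact yangBaxter_of_commute (place12_splitCasimir_commute hhe hhf hef hhk hke hkf)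
    (commute_place23_splitCasimir hhe hhf hef hhk hke hkf) huv huw hvw
end
end
end

section
/- Let c be the contracted Lie algebra with basis h, e, f and brackets [h,e]=4p·e, [h,f]=-4p·f, [e,f]=0 (p ≠ 0), and set ρ = f ⊗ e + e ⊗ f ∈ U(c) ⊗ U(c). Then the three placements ρ₁₂ = ρ ⊗ 1, ρ₁₃, ρ₂₃ in U(c) ⊗ U(c) ⊗ U(c) pairwise commute. (Consequently, the exponentials R(λ) = exp(λ·ρ) formally satisfy the quantum Yang–Baxter equation R₁₂R₁₃R₂₃ = R₂₃R₁₃R₁₂, establishing the pseudotriangularity of the factorized boundary Yangian Y(c).) -/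
noncomputable section
open scoped TensorProduct

/-- The carrier of the contracted Lie algebra `c = (sl(2))^contr` (depends on the parameter `p`);
coordinates are taken with respect to the basis `h, e, f`. -/
def ContrC (_p : ℂ) : Type := ℂ × ℂ × ℂ

namespace ContrC

variable {p : ℂ}

instance : AddCommGroup (ContrC p) := inferInstanceAs (AddCommGroup (ℂ × ℂ × ℂ))
instance : Module ℂ (ContrC p) := inferInstanceAs (Module ℂ (ℂ × ℂ × ℂ))
instance : Module.Finite ℂ (ContrC p) := inferInstanceAs (Module.Finite ℂ (ℂ × ℂ × ℂ))

/-- Build an element of `c` from its coordinates in the basis `h, e, f`. -/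
def mk3 (a b c : ℂ) : ContrC p := (a, b, c)

/-- coefficient of `h` -/
def cH (x : ContrC p) : ℂ := x.1
/-- coefficient of `e` -/
def cE (x : ContrC p) : ℂ := x.2.1
/-- coefficient of `f` -/
def cF (x : ContrC p) : ℂ := x.2.2

/-- The basis vector `h`. -/
def h : ContrC p := mk3 1 0 0
/-- The basis vector `e`. -/
def e : ContrC p := mk3 0 1 0
/-- The basis vector `f`. -/
def f : ContrC p := mk3 0 0 1

/-- The bracket of the contracted Lie algebra `c`: the bilinear antisymmetric extension of
`[h,e] = 4p·e`, `[h,f] = -4p·f`, `[e,f] = 0`. -/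
def br (x y : ContrC p) : ContrC p :=
  mk3 0
      (4 * p * (cH x * cE y - cE x * cH y))
      (-(4 * p) * (cH x * cF y - cF x * cH y))

lemma ext3 {x y : ContrC p} (h1 : cH x = cH y) (h2 : cE x = cE y) (h3 : cF x = cF y) :
    x = y := by
  exact Prod.ext h1 (Prod.ext h2 h3)

@[simp] lemma cH_mk (a b c : ℂ) : cH (mk3 a b c : ContrC p) = a := rfl
@[simp] lemma cE_mk (a b c : ℂ) : cE (mk3 a b c : ContrC p) = b := rfl
@[simp] lemma cF_mk (a b c : ℂ) : cF (mk3 a b c : ContrC p) = c := rfl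

@[simp] lemma cH_add (x y : ContrC p) : cH (x + y) = cH x + cH y := rfl
@[simp] lemma cE_add (x y : ContrC p) : cE (x + y) = cE x + cE y := rfl
@[simp] lemma cF_add (x y : ContrC p) : cF (x + y) = cF x + cF y := rfl

@[simp] lemma cH_smul (t : ℂ) (x : ContrC p) : cH (t • x) = t * cH x := rfl
@[simp] lemma cE_smul (t : ℂ) (x : ContrC p) : cE (t • x) = t * cE x := rfl
@[simp] lemma cF_smul (t : ℂ) (x : ContrC p) : cF (t • x) = t * cF x := rfl

@[simp] lemma cH_zero : cH (0 : ContrC p) = 0 := rfl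
@[simp] lemma cE_zero : cE (0 : ContrC p) = 0 := rfl
@[simp] lemma cF_zero : cF (0 : ContrC p) = 0 := rfl

instance : LieRing (ContrC p) where
  bracket := br
  add_lie x y z := by
    refine ext3 ?_ ?_ ?_ <;>
      simp only [br, cH_mk, cE_mk, cF_mk, cH_add, cE_add, cF_add] <;> ring
  lie_add x y z := by
    refine ext3 ?_ ?_ ?_ <;>
      simp only [br, cH_mk, cE_mk, cF_mk, cH_add, cE_add, cF_add] <;> ring
  lie_self x := by
    refine ext3 ?_ ?_ ?_ <;>
      simp only [br, cH_mk, cE_mk, cF_mk, cH_zero, cE_zero, cF_zero] <;> ring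
  leibniz_lie x y z := by
    refine ext3 ?_ ?_ ?_ <;>
      simp only [br, cH_mk, cE_mk, cF_mk, cH_add, cE_add, cF_add] <;> ring

instance : LieAlgebra ℂ (ContrC p) where
  lie_smul t x y := by
    refine ext3 ?_ ?_ ?_ <;>
      simp only [Bracket.bracket, br, cH_mk, cE_mk, cF_mk, cH_smul, cE_smul, cF_smul] <;> ring

@[simp] lemma lie_def (x y : ContrC p) : ⁅x, y⁆ = br x y := rfl

end ContrC

/-- The universal enveloping algebra `U(c)` of the contracted Lie algebra `c`. -/
abbrev UEnvC (p : ℂ) := UniversalEnvelopingAlgebra ℂ (ContrC p)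

attribute [local instance 100] LieRing.ofAssociativeRing

/-- The canonical embedding `c → U(c)`. -/
def iotaC (p : ℂ) : ContrC p →ₗ⁅ℂ⁆ UEnvC p := UniversalEnvelopingAlgebra.ι ℂ

/-- The element `Ω_c = e ⊗ f + f ⊗ e ∈ U(c) ⊗ U(c)`. -/
def OmegaC (p : ℂ) : UEnvC p ⊗[ℂ] UEnvC p :=
  iotaC p ContrC.e ⊗ₜ iotaC p ContrC.f + iotaC p ContrC.f ⊗ₜ iotaC p ContrC.e

/-- The element `ρ = f ⊗ e + e ⊗ f ∈ U(c) ⊗ U(c)`. -/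
def rhoC (p : ℂ) : UEnvC p ⊗[ℂ] UEnvC p :=
  iotaC p ContrC.f ⊗ₜ iotaC p ContrC.e + iotaC p ContrC.e ⊗ₜ iotaC p ContrC.f

/-- The images of `e` and `f` in `U(c)` commute, since `[e,f] = 0` in `c`. -/
lemma commute_iotaC_e_f (p : ℂ) :
    Commute (iotaC p ContrC.e) (iotaC p ContrC.f) := by
  have hef : ⁅(ContrC.e : ContrC p), (ContrC.f : ContrC p)⁆ = 0 := by
    refine ContrC.ext3 ?_ ?_ ?_ <;> simp [ContrC.br, ContrC.e, ContrC.f]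
  have key := (iotaC p).map_lie ContrC.e ContrC.f
  rw [hef, map_zero, LieRing.of_associative_ring_bracket] at key
  exact sub_eq_zero.mp key.symm

/-- The three placements of `b ⊗ a + a ⊗ b` pairwise commute when `a` and `b` commute. -/
lemma Commute.placements {K : Type*} [CommSemiring K] {U : Type*} [Semiring U] [Algebra K U]
    {a b : U} (hab : Commute a b) :
    Commute (place12 K U (b ⊗ₜ a + a ⊗ₜ b)) (place13 K U (b ⊗ₜ a + a ⊗ₜ b)) ∧
    Commute (place12 K U (b ⊗ₜ a + a ⊗ₜ b)) (place23 K U (b ⊗ₜ a + a ⊗ₜ b)) ∧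
    Commute (place13 K U (b ⊗ₜ a + a ⊗ₜ b)) (place23 K U (b ⊗ₜ a + a ⊗ₜ b)) := by
  have tmul_commute : ∀ {x x' y y' z z' : U}, Commute x x' → Commute y y' → Commute z z' →
      Commute (x ⊗ₜ[K] (y ⊗ₜ[K] z)) (x' ⊗ₜ[K] (y' ⊗ₜ[K] z')) := by
    intro x x' y y' z z' hx hy hz
    simp only [commute_iff_eq, Algebra.TensorProduct.tmul_mul_tmul, hx.eq, hy.eq, hz.eq]
  simp only [place12, place13, place23, map_add, Algebra.TensorProduct.map_tmul,
    Algebra.TensorProduct.includeLeft_apply, Algebra.TensorProduct.includeRight_apply,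
    AlgHom.id_apply]
  refine ⟨?_, ?_, ?_⟩ <;>
    refine Commute.add_left (Commute.add_right ?_ ?_) (Commute.add_right ?_ ?_) <;>
    apply tmul_commute <;>
    simp [hab, hab.symm]

/-- the three placements `ρ₁₂, ρ₁₃, ρ₂₃` of `ρ = f ⊗ e + e ⊗ f` in
`U(c) ⊗ U(c) ⊗ U(c)` pairwise commute (whence the exponentials `R(λ) = exp(λ·ρ)`
formally satisfy the quantum Yang–Baxter equation). -/
theorem statement12 (p : ℂ) (hp : p ≠ 0) :
    Commute (place12 ℂ (UEnvC p) (rhoC p)) (place13 ℂ (UEnvC p) (rhoC p)) ∧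
    Commute (place12 ℂ (UEnvC p) (rhoC p)) (place23 ℂ (UEnvC p) (rhoC p)) ∧
    Commute (place13 ℂ (UEnvC p) (rhoC p)) (place23 ℂ (UEnvC p) (rhoC p)) := by
  exact (commute_iotaC_e_f p).placements
end
end
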